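/- arXiv:2004.14348 — 2 statements merged into one kernel-verified Lean document; each statement's English description precedes it below -/
import Mathlib

section
/- Let f ∈ L¹(ℍ) and suppose there exists η > 0 such that for every λ ∈ (0, η), I_λ f(z,t) = 0 for almost every (z,t) ∈ ℍ. Then f = 0 almost everywhere. (Injectivity of the sub-Riemannian Heisenberg X-ray transform.) -/
noncomputable section

open Complex MeasureTheory Real Set

/-- Heisenberg group multiplication on ℂ × ℝ. -/
def hmul (p q : ℂ × ℝ) : ℂ × ℝ :=
  (p.1 + q.1, p.2 + q.2 + (p.1.re * q.1.im - p.1.im * q.1.re) / 2)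

/-- The model sub-Riemannian geodesic of charge `lam`:
`γ_λ(s) = (R e^{i s / R}, s R / 2)` with `R = 1/λ`. -/
def geo (lam : ℝ) (s : ℝ) : ℂ × ℝ :=
  (((lam : ℂ))⁻¹ * Complex.exp (Complex.I * ((lam * s : ℝ) : ℂ)), s / (2 * lam))

/-- The sub-Riemannian X-ray transform `I_λ f (z,t) = ∫ f((z,t)·γ_λ(s)) ds`. -/
def xray (lam : ℝ) (f : ℂ × ℝ → ℂ) (p : ℂ × ℝ) : ℂ :=
  ∫ s : ℝ, f (hmul p (geo lam s))

theorem ae_eq_zero_of_integral_exp_dual_real {E : Type*} [NormedAddCommGroup E] [NormedSpace ℝ E]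
    [CompleteSpace E] [MeasurableSpace E] [BorelSpace E] [SecondCountableTopology E]
    {μ : Measure E} {u : E → ℝ} (hu : Integrable u μ)
    (h : ∀ L : StrongDual ℝ E, ∫ x, (u x : ℂ) * cexp (L x * I) ∂μ = 0) : u =ᵐ[μ] 0 := by
  have hint (L : StrongDual ℝ E) {v : E → ℝ} (hv : Integrable v μ) :
      Integrable (fun x => (v x : ℂ) * cexp (L x * I)) μ := by
    refine hv.ofReal.mul_bdd (c := 1) (by fun_prop) (ae_of_all _ fun x => ?_)
    rw [Complex.norm_exp_ofReal_mul_I]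
  have hpos : Integrable (fun x => max (u x) 0) μ := hu.pos_part
  have hneg : Integrable (fun x => max (-u x) 0) μ := hu.neg_part
  have hfin {v : E → ℝ} (hv : Integrable v μ) :
      IsFiniteMeasure (μ.withDensity fun x => ENNReal.ofReal (v x)) :=
    isFiniteMeasure_withDensity_ofReal hv.2
  have := hfin hu
  have := hfin hu.neg
  have hchar {v : E → ℝ} (hv : Integrable v μ) (L : StrongDual ℝ E) :
      charFunDual (μ.withDensity fun x => ENNReal.ofReal (v x)) L =
        ∫ x, ((max (v x) 0 : ℝ) : ℂ) * cexp (L x * I) ∂μ := by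
    rw [charFunDual_apply, integral_withDensity_eq_integral_toReal_smul₀
      hv.aemeasurable.ennreal_ofReal (ae_of_all _ fun x => ENNReal.ofReal_lt_top)]
    refine integral_congr_ae (ae_of_all _ fun x => ?_)
    simp [ENNReal.toReal_ofReal']
  have key : μ.withDensity (fun x => ENNReal.ofReal (u x)) =
      μ.withDensity (fun x => ENNReal.ofReal ((-u) x)) := by
    refine Measure.ext_of_charFunDual (funext fun L => ?_)
    rw [hchar hu, hchar hu.neg, ← sub_eq_zero]
    simp only [Pi.neg_apply]
    rw [← integral_sub (hint L hpos) (hint L hneg), ← h L]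
    refine integral_congr_ae (ae_of_all _ fun x => ?_)
    simp only [← sub_mul, ← ofReal_sub]
    congr 2
    rcases le_total (u x) 0 with h0 | h0 <;> simp [h0]
  rw [withDensity_eq_iff hu.aemeasurable.ennreal_ofReal hu.neg.aemeasurable.ennreal_ofReal
    (by simpa using (measure_lt_top (μ.withDensity fun x => ENNReal.ofReal (u x)) univ).ne)] at key
  filter_upwards [key] with x hx
  rcases le_total (u x) 0 with h0 | h0
  · rw [ENNReal.ofReal_of_nonpos h0, eq_comm, ENNReal.ofReal_eq_zero] at hx
    simp only [Pi.neg_apply, Pi.zero_apply] at *; linarith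
  · rw [ENNReal.ofReal_of_nonpos (p := (-u) x) (by simpa), ENNReal.ofReal_eq_zero] at hx
    exact le_antisymm hx h0

theorem ae_eq_zero_of_integral_exp_dual {E : Type*} [NormedAddCommGroup E] [NormedSpace ℝ E]
    [CompleteSpace E] [MeasurableSpace E] [BorelSpace E] [SecondCountableTopology E]
    {μ : Measure E} {f : E → ℂ} (hf : Integrable f μ)
    (h : ∀ L : StrongDual ℝ E, ∫ x, f x * cexp (L x * I) ∂μ = 0) : f =ᵐ[μ] 0 := by
  have hint (L : StrongDual ℝ E) {v : E → ℂ} (hv : Integrable v μ) :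
      Integrable (fun x => v x * cexp (L x * I)) μ := by
    refine hv.mul_bdd (c := 1) (by fun_prop) (ae_of_all _ fun x => ?_)
    rw [Complex.norm_exp_ofReal_mul_I]
  have hconj : Integrable (fun x => (starRingEnd ℂ) (f x)) μ :=
    hf.congr' (by fun_prop) (ae_of_all _ fun x => by simp)
  have hc (L : StrongDual ℝ E) : ∫ x, (starRingEnd ℂ) (f x) * cexp (L x * I) ∂μ = 0 := by
    rw [← map_zero (starRingEnd ℂ), ← h (-L), ← integral_conj]
    refine integral_congr_ae (ae_of_all _ fun x => ?_)
    simp [← Complex.exp_conj]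
  have hre := ae_eq_zero_of_integral_exp_dual_real hf.re fun L => by
    rw [← mul_zero (2⁻¹ : ℂ), ← add_zero (0 : ℂ)]
    nth_rewrite 1 [← h L]
    rw [← hc L, ← integral_add (hint L hf) (hint L hconj), ← integral_const_mul]
    refine integral_congr_ae (ae_of_all _ fun x => ?_)
    simp only [RCLike.re_eq_complex_re, Complex.re_eq_add_conj]
    ring
  have him := ae_eq_zero_of_integral_exp_dual_real hf.im fun L => by
    rw [← mul_zero ((2 * I)⁻¹ : ℂ), ← sub_zero (0 : ℂ)]
    nth_rewrite 1 [← h L]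
    rw [← hc L, ← integral_sub (hint L hf) (hint L hconj), ← integral_const_mul]
    refine integral_congr_ae (ae_of_all _ fun x => ?_)
    simp only [RCLike.im_eq_complex_im, Complex.im_eq_sub_conj]
    ring
  filter_upwards [hre, him] with x h1 h2
  exact Complex.ext h1 h2

open Polynomial in
theorem exists_sum_choose_mul_pow_div_factorial_ne_zero (k n₀ : ℕ) : ∃ n : ℕ, n₀ ≤ n ∧ 0 < n ∧
    ∑ i ∈ Finset.range (k + 1), ((n + k).choose i : ℂ) * (-(n : ℂ)) ^ (k - i) / (k - i).factorial
      ≠ 0 := by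
  set p : ℂ[X] := ∑ i ∈ Finset.range (k + 1),
    C ((i.factorial : ℂ)⁻¹ * ((k - i).factorial : ℂ)⁻¹) *
      ((descPochhammer ℂ i).comp (X + C (k : ℂ)) * (-X) ^ (k - i)) with hp
  have heval (n : ℕ) : p.eval (n : ℂ) = ∑ i ∈ Finset.range (k + 1),
      ((n + k).choose i : ℂ) * (-(n : ℂ)) ^ (k - i) / (k - i).factorial := by
    rw [hp, eval_finsetSum]
    refine Finset.sum_congr rfl fun i _ => ?_
    rw [Nat.cast_choose_eq_descPochhammer_div]
    simp only [eval_mul, eval_C, eval_comp, eval_add, eval_X, eval_pow, eval_neg, Nat.cast_add]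
    ring
  have hp0 : p ≠ 0 := by
    intro h0
    have := heval 0
    rw [h0, eval_zero, Finset.sum_range_succ, Finset.sum_eq_zero] at this
    · simp at this
    · intro i hi
      rw [Finset.mem_range] at hi
      simp [Nat.sub_ne_zero_of_lt hi]
  have hfin : {n : ℕ | p.eval (n : ℂ) = 0}.Finite :=
    (p.rootSet_finite ℂ |>.preimage Nat.cast_injective.injOn).subset fun n hn => by
      simpa [mem_rootSet, hp0] using hn
  obtain ⟨n, hn, hn'⟩ := (hfin.infinite_compl).exists_gt n₀
  exact ⟨n, hn'.le, by omega, by rw [← heval]; exact hn⟩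

theorem integral_exp_int_mul_Ioc {lam : ℝ} (hlam : 0 < lam) (m : ℤ) :
    ∫ s in Ioc 0 (2 * π / lam), cexp (I * ((lam * s : ℝ) : ℂ)) ^ m =
      if m = 0 then ((2 * π / lam : ℝ) : ℂ) else 0 := by
  rw [← intervalIntegral.integral_of_le (by positivity)]
  split_ifs with hm
  · simp [hm]
  · have hl : (lam : ℂ) ≠ 0 := by exact_mod_cast hlam.ne'
    have hc : (m * I * lam : ℂ) ≠ 0 := by simp [hm, hl]
    have : ∀ s : ℝ, cexp (I * ((lam * s : ℝ) : ℂ)) ^ m = cexp ((m * I * lam : ℂ) * s) := by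
      intro s
      rw [← Complex.exp_int_mul]; congr 1; push_cast; ring
    simp_rw [this]
    rw [integral_exp_mul_complex hc]
    have : (m * I * lam : ℂ) * ((2 * π / lam : ℝ) : ℂ) = m * (2 * π * I) := by
      push_cast; field_simp
    rw [this, Complex.exp_int_mul_two_pi_mul_I]; simp

theorem integral_exp_zpow_mul_exp {lam : ℝ} (hlam : 0 < lam) (c : ℂ) (m : ℤ) :
    ∫ s in Ioc 0 (2 * π / lam), cexp (I * ((lam * s : ℝ) : ℂ)) ^ m *
        cexp (c * cexp (I * ((lam * s : ℝ) : ℂ))) =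
      if m ≤ 0 then ((2 * π / lam : ℝ) : ℂ) * (c ^ m.natAbs / m.natAbs.factorial) else 0 := by
  have hnorm (s : ℝ) : ‖cexp (I * ((lam * s : ℝ) : ℂ))‖ = 1 := by
    rw [mul_comm, Complex.norm_exp_ofReal_mul_I]
  have hz (s : ℝ) : cexp (I * ((lam * s : ℝ) : ℂ)) ≠ 0 := Complex.exp_ne_zero _
  set F : ℕ → ℝ → ℂ := fun j s =>
    (c ^ j / j.factorial) * cexp (I * ((lam * s : ℝ) : ℂ)) ^ (m + j) with hF
  have hsum : HasSum (fun j => ∫ s in Ioc 0 (2 * π / lam), F j s)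
      (∫ s in Ioc 0 (2 * π / lam), cexp (I * ((lam * s : ℝ) : ℂ)) ^ m *
        cexp (c * cexp (I * ((lam * s : ℝ) : ℂ)))) := by
    refine hasSum_integral_of_dominated_convergence (fun j _ => ‖c‖ ^ j / j.factorial) ?_ ?_ ?_ ?_ ?_
    · intro j
      refine Continuous.aestronglyMeasurable ?_
      refine continuous_const.mul (Continuous.zpow₀ (by fun_prop) _ fun s => Or.inl (hz s))
    · intro j
      refine ae_of_all _ fun s => ?_
      rw [hF, norm_mul, norm_zpow, hnorm]
      simp
    · exact ae_of_all _ fun _ => Real.summable_pow_div_factorial _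
    · exact integrable_const _
    · refine ae_of_all _ fun s => ?_
      have := (NormedSpace.expSeries_div_hasSum_exp (c * cexp (I * ((lam * s : ℝ) : ℂ)))).mul_left
        (cexp (I * ((lam * s : ℝ) : ℂ)) ^ m)
      rw [← Complex.exp_eq_exp_ℂ] at this
      refine this.congr_fun ?_
      intro j
      simp only [hF]
      rw [zpow_add₀ (hz s), mul_pow, zpow_natCast]
      ring
  have hterm (j : ℕ) : ∫ s in Ioc 0 (2 * π / lam), F j s =
      if m + j = 0 then ((2 * π / lam : ℝ) : ℂ) * (c ^ j / j.factorial) else 0 := by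
    rw [hF, integral_const_mul, integral_exp_int_mul_Ioc hlam]
    split_ifs <;> ring
  refine hsum.unique ?_
  simp_rw [hterm]
  split_ifs with hm
  · have := hasSum_ite_eq m.natAbs (((2 * π / lam : ℝ) : ℂ) * (c ^ m.natAbs / m.natAbs.factorial))
    convert this using 2 with j
    by_cases hj : j = m.natAbs
    · subst hj
      rw [if_pos (by omega), if_pos rfl]
    · rw [if_neg (by omega), if_neg hj]
  · convert hasSum_zero using 2 with j
    rw [if_neg (by omega)]

theorem isAddLeftInvariant_volume_prod {G H : Type*} [MeasureSpace G] [MeasureSpace H] [AddGroup G]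
    [AddGroup H] [MeasurableAdd G] [MeasurableAdd H] [SFinite (volume : Measure G)]
    [SFinite (volume : Measure H)] [(volume : Measure G).IsAddLeftInvariant]
    [(volume : Measure H).IsAddLeftInvariant] :
    (volume : Measure (G × H)).IsAddLeftInvariant :=
  Measure.prod.instIsAddLeftInvariant

theorem continuous_geo (lam : ℝ) : Continuous (geo lam) := by
  unfold geo
  fun_prop

theorem continuous_hmul : Continuous fun x : (ℂ × ℝ) × (ℂ × ℝ) => hmul x.1 x.2 := by
  unfold hmul
  fun_prop

theorem measurePreserving_hmul_right (q : ℂ × ℝ) :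
    MeasurePreserving (fun p => hmul p q) volume volume := by
  have h := MeasurePreserving.skew_product (measurePreserving_add_right (volume : Measure ℂ) q.1)
    (g := fun z t => t + q.2 + (z.re * q.1.im - z.im * q.1.re) / 2) (μc := volume) (μd := volume)
    (by unfold Function.uncurry; fun_prop)
    (ae_of_all _ fun z => by
      simpa only [add_assoc] using map_add_right_eq_self (volume : Measure ℝ) _)
  exact h

theorem measurePreserving_prodMk_hmul_geo (lam : ℝ) (μ : Measure ℝ) [SFinite μ] :
    MeasurePreserving (fun x : ℝ × (ℂ × ℝ) => (x.1, hmul x.2 (geo lam x.1)))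
      (μ.prod volume) (μ.prod volume) := by
  refine MeasurePreserving.skew_product (MeasurePreserving.id μ)
    (g := fun s p => hmul p (geo lam s)) ?_
    (ae_of_all _ fun s => (measurePreserving_hmul_right _).map_eq)
  exact (continuous_hmul.comp (by
    have := continuous_geo lam
    fun_prop : Continuous fun x : ℝ × (ℂ × ℝ) => (x.2, geo lam x.1))).measurable

theorem geo_sub_zsmul_period {lam : ℝ} (hlam : 0 < lam) (k : ℤ) (s : ℝ) :
    geo lam (s - k * (2 * π / lam)) = ((geo lam s).1, (geo lam s).2 - k * (π / lam ^ 2)) := by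
  unfold geo
  ext1
  · dsimp only
    have hl : (lam : ℂ) ≠ 0 := by exact_mod_cast hlam.ne'
    congr 1
    rw [show I * ((lam * (s - k * (2 * π / lam)) : ℝ) : ℂ) =
      I * ((lam * s : ℝ) : ℂ) - k * (2 * π * I) by push_cast; field_simp, Complex.exp_sub,
      Complex.exp_int_mul_two_pi_mul_I, div_one]
  · dsimp only
    field_simp

theorem isAddFundamentalDomain_zmultiples {α : Type*} [AddCommGroup α] [MeasurableSpace α]
    {μ : Measure α} {v : α} (φ : α →+ ℝ) (hφ : φ v ≠ 0) {T : ℝ} (hT : 0 < T) (hv : |φ v| = T)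
    (hm : Measurable φ) :
    IsAddFundamentalDomain (AddSubgroup.zmultiples v) (φ ⁻¹' Ioc 0 T) μ := by
  refine IsAddFundamentalDomain.mk' (hm measurableSet_Ioc).nullMeasurableSet fun x => ?_
  have hinj : Function.Injective fun n : ℤ => n • φ v := fun m n hmn => by
    simpa [hφ] using hmn
  obtain ⟨n, hn, huniq⟩ : ∃! n : ℤ, φ x + n • φ v ∈ Ioc 0 T := by
    rcases abs_choice (φ v) with h | h
    · simpa [← hv, h] using existsUnique_add_zsmul_mem_Ioc hT (φ x) 0
    · have hT' : φ v = -T := by linarith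
      obtain ⟨n, hn, hu⟩ := existsUnique_add_zsmul_mem_Ioc hT (φ x) 0
      refine ⟨-n, by simpa [hT'] using hn, fun m hm => ?_⟩
      rw [← hu (-m) (by simpa [hT'] using hm), neg_neg]
  refine ⟨⟨n • v, n, rfl⟩, ?_, ?_⟩
  · simpa [AddSubgroup.vadd_def, add_comm] using hn
  · rintro ⟨_, m, rfl⟩ hm
    have : m = n := huniq m (by simpa [AddSubgroup.vadd_def, add_comm] using hm)
    subst this
    rfl

/-- The kernel obtained by pairing the circle of radius `lam⁻¹` with a test function, twisted by the
character of the centre of frequency `2 * n * lam ^ 2`. -/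
def twistedKernel (lam : ℝ) (n : ℕ) (h : ℂ → ℂ) (w : ℂ) : ℂ :=
  ∫ s in Ioc 0 (2 * π / lam), h (w - (geo lam s).1) * cexp (I * ((2 * n * lam ^ 2 *
    ((geo lam s).2 + (w.re * (geo lam s).1.im - w.im * (geo lam s).1.re) / 2) : ℝ) : ℂ))

theorem integral_mul_twistedKernel_eq_zero {f : ℂ × ℝ → ℂ} (hf : Integrable f) {lam : ℝ}
    (hlam : 0 < lam) (hI : ∀ᵐ p : ℂ × ℝ, xray lam f p = 0) (n : ℕ) {h : ℂ → ℂ} (hc : Continuous h)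
    {C : ℝ} (hC : ∀ z, ‖h z‖ ≤ C) :
    ∫ p : ℂ × ℝ, f p * cexp (-I * ((2 * n * lam ^ 2 * p.2 : ℝ) : ℂ)) *
      twistedKernel lam n h p.1 = 0 := by
  have hl : (lam : ℂ) ≠ 0 := by exact_mod_cast hlam.ne'
  have hcont := continuous_geo lam
  set P : ℝ := 2 * π / lam with hP
  set T : ℝ := π / lam ^ 2 with hT
  have hP0 : 0 < P := by positivity
  have hT0 : 0 < T := by positivity
  set G : ℝ × (ℂ × ℝ) → ℂ := fun x => f x.2 * (cexp (-I * ((2 * n * lam ^ 2 * x.2.2 : ℝ) : ℂ)) *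
    (h (x.2.1 - (geo lam x.1).1) * cexp (I * ((2 * n * lam ^ 2 * ((geo lam x.1).2 +
      (x.2.1.re * (geo lam x.1).1.im - x.2.1.im * (geo lam x.1).1.re) / 2) : ℝ) : ℂ)))) with hG
  set H : ℝ × (ℂ × ℝ) → ℂ := fun x => f (hmul x.2 (geo lam x.1)) *
    (h x.2.1 * cexp (-I * ((2 * n * lam ^ 2 * x.2.2 : ℝ) : ℂ))) with hH
  set Φ : ℝ × (ℂ × ℝ) → ℝ × (ℂ × ℝ) := fun x => (x.1, hmul x.2 (geo lam x.1)) with hΦ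
  have hGH : H = G ∘ Φ := by
    funext x
    simp only [hG, hH, hΦ, Function.comp_apply]
    congr 1
    simp only [hmul, add_sub_cancel_right]
    rw [mul_left_comm, ← Complex.exp_add]
    congr 2
    simp only [add_re, add_im]
    push_cast
    ring
  have hGint : Integrable G ((volume.restrict (Ioc 0 P)).prod volume) := by
    refine (hf.comp_snd _).mul_bdd (c := C) (Continuous.aestronglyMeasurable (by fun_prop))
      (ae_of_all _ fun x => ?_)
    rw [norm_mul, norm_mul, neg_mul, ← mul_neg, ← ofReal_neg, Complex.norm_exp_I_mul_ofReal,
      Complex.norm_exp_I_mul_ofReal, one_mul, mul_one]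
    exact hC _
  have hmp := measurePreserving_prodMk_hmul_geo lam (volume.restrict (Ioc 0 P))
  have hHint : Integrable H ((volume.restrict (Ioc 0 P)).prod volume) := by
    rw [hGH]
    exact hmp.integrable_comp_of_integrable hGint
  have hHG : ∫ x, H x ∂((volume.restrict (Ioc 0 P)).prod volume) =
      ∫ x, G x ∂((volume.restrict (Ioc 0 P)).prod volume) := by
    have := integral_map hmp.measurable.aemeasurable (f := G)
      (by rw [hmp.map_eq]; exact hGint.aestronglyMeasurable)
    rw [hmp.map_eq] at this
    rw [this, hGH]
    rfl
  have hGval : ∫ x, G x ∂((volume.restrict (Ioc 0 P)).prod volume) =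
      ∫ p : ℂ × ℝ, f p * cexp (-I * ((2 * n * lam ^ 2 * p.2 : ℝ) : ℂ)) *
        twistedKernel lam n h p.1 := by
    rw [integral_prod_symm _ hGint]
    refine integral_congr_ae (ae_of_all _ fun p => ?_)
    simp only [hG, twistedKernel, integral_const_mul]
    ring
  set v : ℝ × (ℂ × ℝ) := (-P, (0, T)) with hv
  have hleft : (volume : Measure (ℝ × (ℂ × ℝ))).IsAddLeftInvariant := by
    have := isAddLeftInvariant_volume_prod (G := ℂ) (H := ℝ)
    exact isAddLeftInvariant_volume_prod
  have hinv : VAddInvariantMeasure (AddSubgroup.zmultiples v) (ℝ × (ℂ × ℝ)) volume :=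
    ⟨fun c s _ => measure_preimage_add volume (c : ℝ × (ℂ × ℝ)) s⟩
  have hd2 := isAddFundamentalDomain_zmultiples (μ := volume) (v := v)
    (AddMonoidHom.fst ℝ (ℂ × ℝ)) (by simp [hv, hP0.ne']) hP0 (by simp [hv, abs_of_pos hP0])
    measurable_fst
  have hd1 := isAddFundamentalDomain_zmultiples (μ := volume) (v := v)
    ((AddMonoidHom.snd ℂ ℝ).comp (AddMonoidHom.snd ℝ (ℂ × ℝ))) (by simp [hv, hT0.ne']) hT0
    (by simp [hv, abs_of_pos hT0]) (measurable_snd.comp measurable_snd)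
  have hHinv : ∀ (g : AddSubgroup.zmultiples v) (x : ℝ × (ℂ × ℝ)), H (g +ᵥ x) = H x := by
    rintro ⟨_, k, rfl⟩ ⟨s, z, t⟩
    have e : (⟨(fun m : ℤ => m • v) k, k, rfl⟩ : AddSubgroup.zmultiples v) +ᵥ (s, (z, t)) =
        (s - k * P, (z, t + k * T)) := by
      simp [AddSubgroup.vadd_def, hv]
      constructor <;> ring
    rw [e]
    simp only [hH]
    rw [geo_sub_zsmul_period hlam]
    congr 2
    · unfold hmul
      ext1
      · rfl
      · dsimp only
        ring
    · rw [show -I * ((2 * n * lam ^ 2 * (t + k * T) : ℝ) : ℂ) =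
        -I * ((2 * n * lam ^ 2 * t : ℝ) : ℂ) - ((n * k : ℤ) : ℂ) * (2 * π * I) by
          rw [hT]; push_cast; field_simp; ring, Complex.exp_sub,
        Complex.exp_int_mul_two_pi_mul_I, div_one]
  have hs2 : (AddMonoidHom.fst ℝ (ℂ × ℝ)) ⁻¹' Ioc 0 P = Ioc 0 P ×ˢ univ := by
    ext; simp
  have hs1 : ((AddMonoidHom.snd ℂ ℝ).comp (AddMonoidHom.snd ℝ (ℂ × ℝ))) ⁻¹' Ioc 0 T =
      univ ×ˢ (univ ×ˢ Ioc 0 T) := by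
    ext; simp
  have hr2 : (volume : Measure (ℝ × (ℂ × ℝ))).restrict (Ioc 0 P ×ˢ univ) =
      (volume.restrict (Ioc 0 P)).prod volume := by
    rw [Measure.volume_eq_prod, ← Measure.prod_restrict, Measure.restrict_univ]
  have hr1 : (volume : Measure (ℝ × (ℂ × ℝ))).restrict (univ ×ˢ (univ ×ˢ Ioc 0 T)) =
      volume.prod (volume.restrict (univ ×ˢ Ioc 0 T)) := by
    rw [Measure.volume_eq_prod, ← Measure.prod_restrict, Measure.restrict_univ]
  have heq := hd1.setIntegral_eq hd2 hHinv
  have hon := (hd1.integrableOn_iff hd2 hHinv).2 (by rw [IntegrableOn, hs2, hr2]; exact hHint)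
  rw [IntegrableOn, hs1, hr1] at hon
  rw [hs1, hs2, hr1, hr2, integral_prod_symm _ hon, hHG, hGval] at heq
  rw [← heq]
  refine integral_eq_zero_of_ae ?_
  filter_upwards [ae_restrict_of_ae hI] with p hp
  simp only [hH, integral_mul_const]
  rw [show ∫ s, f (hmul p (geo lam s)) = 0 from hp, zero_mul]
  rfl

/-- The Gaussian of the Fock space at frequency `tau`, tilted by `exp (a * z + b * conj z)`. -/
def fockExp (tau : ℝ) (a b z : ℂ) : ℂ :=
  cexp (-(tau / 4) * (z * (starRingEnd ℂ) z) + a * z + b * (starRingEnd ℂ) z)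

theorem continuous_fockExp (tau : ℝ) (a b : ℂ) : Continuous (fockExp tau a b) := by
  unfold fockExp
  fun_prop

theorem norm_fockExp_mul_exp_le {tau : ℝ} (htau : 0 < tau) (a b z : ℂ) (r : ℝ) :
    ‖fockExp tau a b z‖ * rexp (r * ‖z‖) ≤ rexp ((‖a‖ + ‖b‖ + r) ^ 2 / tau) := by
  rw [fockExp, Complex.norm_exp, ← Real.exp_add, Real.exp_le_exp]
  have h1 : (a * z).re ≤ ‖a‖ * ‖z‖ := (Complex.re_le_norm _).trans (norm_mul_le _ _)
  have h2 : (b * (starRingEnd ℂ) z).re ≤ ‖b‖ * ‖z‖ :=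
    (Complex.re_le_norm _).trans ((norm_mul_le _ _).trans_eq (by rw [RCLike.norm_conj]))
  have h3 : (-(tau / 4 : ℂ) * (z * (starRingEnd ℂ) z)).re = -(tau / 4) * ‖z‖ ^ 2 := by
    rw [Complex.mul_conj, Complex.normSq_eq_norm_sq]
    rw [show -(tau / 4 : ℂ) * ((‖z‖ ^ 2 : ℝ) : ℂ) = ((-(tau / 4) * ‖z‖ ^ 2 : ℝ) : ℂ) by push_cast; ring,
      ofReal_re]
  rw [add_re, add_re, h3]
  have h4 : (‖a‖ + ‖b‖ + r) * ‖z‖ ≤ tau / 4 * ‖z‖ ^ 2 + (‖a‖ + ‖b‖ + r) ^ 2 / tau := by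
    have := sq_nonneg (tau / 2 * ‖z‖ - (‖a‖ + ‖b‖ + r))
    rw [← sub_nonneg]
    have e : tau / 4 * ‖z‖ ^ 2 + (‖a‖ + ‖b‖ + r) ^ 2 / tau - (‖a‖ + ‖b‖ + r) * ‖z‖ =
      (tau / 2 * ‖z‖ - (‖a‖ + ‖b‖ + r)) ^ 2 / tau := by field_simp; ring
    rw [e]; positivity
  linarith

theorem norm_fockExp_le {tau : ℝ} (htau : 0 < tau) (a b z : ℂ) :
    ‖fockExp tau a b z‖ ≤ rexp ((‖a‖ + ‖b‖) ^ 2 / tau) := by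
  simpa using norm_fockExp_mul_exp_le htau a b z 0

theorem norm_fockExp_mul_pow_le {tau : ℝ} (htau : 0 < tau) (a b z : ℂ) (N : ℕ) :
    ‖fockExp tau a b z * (starRingEnd ℂ) z ^ N‖ ≤
      N.factorial * rexp ((‖a‖ + ‖b‖ + 1) ^ 2 / tau) := by
  rw [norm_mul, norm_pow, RCLike.norm_conj]
  have h1 := Real.pow_div_factorial_le_exp ‖z‖ (norm_nonneg _) N
  rw [div_le_iff₀ (by positivity)] at h1
  calc _ ≤ ‖fockExp tau a b z‖ * (rexp (1 * ‖z‖) * N.factorial) := by rw [one_mul]; gcongr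
    _ = N.factorial * (‖fockExp tau a b z‖ * rexp (1 * ‖z‖)) := by ring
    _ ≤ _ := by gcongr; exact norm_fockExp_mul_exp_le htau a b z 1

theorem twistedKernel_fockExp_mul_pow {lam : ℝ} (hlam : 0 < lam) (n k : ℕ) (a w : ℂ) :
    twistedKernel lam n (fun z => fockExp (2 * n * lam ^ 2) a 0 z * (starRingEnd ℂ) z ^ (n + k)) w =
      ((2 * π / lam : ℝ) : ℂ) * cexp (-(n / 2)) * (-(lam : ℂ)⁻¹) ^ n *
        (fockExp (2 * n * lam ^ 2) a 0 w * ∑ i ∈ Finset.range (k + 1), ((n + k).choose i : ℂ) *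
          (starRingEnd ℂ) w ^ i *
          ((-(n : ℂ) * (starRingEnd ℂ) w + a / lam ^ 2) ^ (k - i) / (k - i).factorial)) := by
  have hl : (lam : ℂ) ≠ 0 := by exact_mod_cast hlam.ne'
  set c : ℂ := (n * lam ^ 2 * (starRingEnd ℂ) w - a) * (lam : ℂ)⁻¹ with hc
  set B : ℂ := cexp (-(n / 2)) * fockExp (2 * n * lam ^ 2) a 0 w with hB
  clear_value c B
  have hpt (s : ℝ) : fockExp (2 * n * lam ^ 2) a 0 (w - (geo lam s).1) *
      (starRingEnd ℂ) (w - (geo lam s).1) ^ (n + k) * cexp (I * ((2 * n * lam ^ 2 *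
      ((geo lam s).2 + (w.re * (geo lam s).1.im - w.im * (geo lam s).1.re) / 2) : ℝ) : ℂ)) =
      ∑ i ∈ Finset.range (n + k + 1), (B * (((n + k).choose i : ℂ) * (starRingEnd ℂ) w ^ i *
        (-(lam : ℂ)⁻¹) ^ (n + k - i))) *
        (cexp (I * ((lam * s : ℝ) : ℂ)) ^ ((i : ℤ) - k) *
        cexp (c * cexp (I * ((lam * s : ℝ) : ℂ)))) := by
    set u := cexp (I * ((lam * s : ℝ) : ℂ)) with hu
    have hu0 : u ≠ 0 := Complex.exp_ne_zero _
    have hub : (starRingEnd ℂ) u = u⁻¹ := by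
      rw [hu, ← Complex.exp_conj, ← Complex.exp_neg]
      simp
    have hun : u ^ n = cexp (n * (I * ((lam * s : ℝ) : ℂ))) := by rw [hu, ← Complex.exp_nat_mul]
    have hg1 : (geo lam s).1 = (lam : ℂ)⁻¹ * u := rfl
    have hg2 : (geo lam s).2 = s / (2 * lam) := rfl
    have homega : ((w.re * (geo lam s).1.im - w.im * (geo lam s).1.re : ℝ) : ℂ) =
        ((starRingEnd ℂ) w * ((lam : ℂ)⁻¹ * u) - w * ((lam : ℂ)⁻¹ * u⁻¹)) / (2 * I) := by
      rw [← hub, ← hg1]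
      have : (lam : ℂ)⁻¹ * (starRingEnd ℂ) u = (starRingEnd ℂ) (geo lam s).1 := by
        rw [hg1, map_mul, map_inv₀, Complex.conj_ofReal]
      rw [this]
      generalize (geo lam s).1 = q
      rw [eq_div_iff (by simp)]
      apply Complex.ext
      · simp
      · simp
        ring
    have hexp : fockExp (2 * n * lam ^ 2) a 0 (w - (geo lam s).1) * cexp (I * ((2 * n * lam ^ 2 *
        ((geo lam s).2 + (w.re * (geo lam s).1.im - w.im * (geo lam s).1.re) / 2) : ℝ) : ℂ)) =
        B * (u ^ n * cexp (c * u)) := by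
      rw [hB, hun, fockExp, fockExp, ← Complex.exp_add, ← Complex.exp_add, ← Complex.exp_add,
        ← Complex.exp_add]
      congr 1
      rw [ofReal_mul (2 * n * lam ^ 2) _, ofReal_add, ofReal_div _ 2, homega, hg1, hg2, map_sub, map_mul, map_inv₀,
        Complex.conj_ofReal, hub, hc]
      push_cast
      field_simp
      ring
    rw [mul_right_comm, hexp, hg1, map_sub, map_mul, map_inv₀, Complex.conj_ofReal, hub,
      sub_eq_add_neg, add_pow, Finset.mul_sum]
    refine Finset.sum_congr rfl fun i hi => ?_
    rw [Finset.mem_range] at hi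
    have hui : u ^ ((i : ℤ) - k) = u ^ n * u⁻¹ ^ (n + k - i) := by
      rw [← zpow_natCast u n, inv_pow, ← zpow_natCast u (n + k - i), ← zpow_neg, ← zpow_add₀ hu0]
      congr 1
      omega
    rw [hui, ← neg_mul, mul_pow]
    ring
  rw [twistedKernel]
  simp_rw [hpt]
  rw [integral_finsetSum]
  swap
  · intro i _
    refine Integrable.const_mul ?_ _
    refine (Continuous.integrableOn_Icc ?_).mono_set Ioc_subset_Icc_self
    exact (Continuous.zpow₀ (by fun_prop) _ fun s => Or.inl (Complex.exp_ne_zero _)).mul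
      (by fun_prop)
  simp_rw [integral_const_mul, integral_exp_zpow_mul_exp hlam]
  rw [← Finset.sum_subset (Finset.range_mono (by omega : k + 1 ≤ n + k + 1))]
  · rw [Finset.mul_sum, Finset.mul_sum]
    refine Finset.sum_congr rfl fun i hi => ?_
    rw [Finset.mem_range] at hi
    rw [if_pos (by omega), show ((i : ℤ) - k).natAbs = k - i by omega,
      show n + k - i = n + (k - i) by omega, pow_add, hB]
    have : (-(n : ℂ) * (starRingEnd ℂ) w + a / lam ^ 2) = -(lam : ℂ)⁻¹ * c := by
      rw [hc]; field_simp; ring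
    rw [this, mul_pow]
    ring
  · intro i hi hi'
    rw [Finset.mem_range] at hi hi'
    rw [if_neg (by omega), mul_zero]

theorem norm_exp_neg_I_mul_ofReal (x : ℝ) : ‖cexp (-I * (x : ℂ))‖ = 1 := by
  rw [neg_mul, ← mul_neg, ← ofReal_neg, Complex.norm_exp_I_mul_ofReal]

theorem integrable_mul_exp_neg_mul_comp_fst {f : ℂ × ℝ → ℂ} (hf : Integrable f) (tau : ℝ)
    {h : ℂ → ℂ} (hc : Continuous h) {C : ℝ} (hC : ∀ z, ‖h z‖ ≤ C) :
    Integrable fun p : ℂ × ℝ => f p * cexp (-I * ((tau * p.2 : ℝ) : ℂ)) * h p.1 := by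
  refine (hf.mul_bdd (c := 1) (Continuous.aestronglyMeasurable (by fun_prop))
    (ae_of_all _ fun p => (norm_exp_neg_I_mul_ofReal _).le)).mul_bdd (c := C)
    (Continuous.aestronglyMeasurable (by fun_prop)) (ae_of_all _ fun p => hC _)

/-- The injectivity hypothesis: the X-ray transform of `f` vanishes for all small charges. -/
def XrayVanishes (f : ℂ × ℝ → ℂ) : Prop :=
  ∃ η : ℝ, 0 < η ∧ ∀ lam ∈ Set.Ioo (0 : ℝ) η, ∀ᵐ p : ℂ × ℝ, xray lam f p = 0

open Polynomial in
theorem integral_fockExp_mul_conj_pow_eq_zero {f : ℂ × ℝ → ℂ} (hf : Integrable f)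
    (hX : XrayVanishes f) {tau : ℝ} (htau : 0 < tau) (a : ℂ) (k : ℕ) :
    ∫ p : ℂ × ℝ, f p * cexp (-I * ((tau * p.2 : ℝ) : ℂ)) *
      (fockExp tau a 0 p.1 * (starRingEnd ℂ) p.1 ^ k) = 0 := by
  induction k using Nat.strong_induction_on with
  | _ k ih =>
  obtain ⟨η, hη, hI⟩ := hX
  obtain ⟨n, hn, hn0, hne⟩ :=
    exists_sum_choose_mul_pow_div_factorial_ne_zero k (⌊tau / (2 * η ^ 2)⌋₊ + 1)
  have hn0' : (0 : ℝ) < n := by exact_mod_cast hn0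
  set lam : ℝ := √(tau / (2 * n)) with hlam
  have hlam0 : 0 < lam := Real.sqrt_pos.2 (by positivity)
  have hsq : 2 * n * lam ^ 2 = tau := by
    rw [hlam, Real.sq_sqrt (by positivity)]
    field_simp
  have hlamη : lam < η := by
    rw [hlam, Real.sqrt_lt' hη, div_lt_iff₀ (by positivity)]
    have : tau / (2 * η ^ 2) < n := (Nat.lt_floor_add_one _).trans_le (by exact_mod_cast hn)
    rw [div_lt_iff₀ (by positivity)] at this
    linarith
  have hconj : Continuous (starRingEnd ℂ) := Complex.continuous_conj
  have hcont (m : ℕ) : Continuous fun z => fockExp tau a 0 z * (starRingEnd ℂ) z ^ m :=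
    (continuous_fockExp tau a 0).mul (hconj.pow m)
  have hrel := integral_mul_twistedKernel_eq_zero hf hlam0 (hI lam ⟨hlam0, hlamη⟩) n
    (hcont (n + k)) (norm_fockExp_mul_pow_le htau a 0 · (n + k))
  have hker (w : ℂ) := twistedKernel_fockExp_mul_pow hlam0 n k a w
  rw [hsq] at hrel hker
  set Q : ℂ[X] := ∑ i ∈ Finset.range (k + 1), C (((n + k).choose i : ℂ) / (k - i).factorial) *
    (X ^ i * (C (-(n : ℂ)) * X + C (a / lam ^ 2)) ^ (k - i)) with hQ
  have hQeval (w : ℂ) : Q.eval w = ∑ i ∈ Finset.range (k + 1), ((n + k).choose i : ℂ) * w ^ i *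
      ((-(n : ℂ) * w + a / lam ^ 2) ^ (k - i) / (k - i).factorial) := by
    rw [hQ, eval_finsetSum]
    refine Finset.sum_congr rfl fun i _ => ?_
    simp only [eval_mul, eval_C, eval_pow, eval_X, eval_add]
    ring
  have hdeg1 (m : ℕ) : ((C (-(n : ℂ)) * X + C (a / lam ^ 2)) ^ m).natDegree ≤ m :=
    (natDegree_pow_le_of_le m natDegree_linear_le).trans_eq (mul_one m)
  have hQdeg : Q.natDegree < k + 1 := by
    refine Nat.lt_succ_of_le (natDegree_sum_le_of_forall_le _ _ fun i hi => ?_)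
    rw [Finset.mem_range] at hi
    refine (natDegree_C_mul_le _ _).trans (natDegree_mul_le.trans ?_)
    have := hdeg1 (k - i)
    rw [natDegree_X_pow]
    omega
  have hQcoeff : Q.coeff k ≠ 0 := by
    convert hne using 1
    rw [hQ, finsetSum_coeff]
    refine Finset.sum_congr rfl fun i hi => ?_
    rw [Finset.mem_range] at hi
    obtain ⟨m, rfl⟩ : ∃ m, k = m + i := ⟨k - i, by omega⟩
    rw [coeff_C_mul, coeff_X_pow_mul, Nat.add_sub_cancel]
    have := coeff_pow_of_natDegree_le (p := C (-(n : ℂ)) * X + C (a / lam ^ 2)) (m := m)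
      natDegree_linear_le
    rw [mul_one] at this
    rw [this]
    simp
    ring
  set D : ℂ := ((2 * π / lam : ℝ) : ℂ) * cexp (-(n / 2)) * (-(lam : ℂ)⁻¹) ^ n with hD
  have hD0 : D ≠ 0 := by
    have hl : (lam : ℂ) ≠ 0 := by exact_mod_cast hlam0.ne'
    rw [hD]
    refine mul_ne_zero (mul_ne_zero ?_ (Complex.exp_ne_zero _)) (pow_ne_zero _ (by simpa using hl))
    exact_mod_cast (by positivity : (2 * π / lam) ≠ 0)
  have hsum : ∑ i ∈ Finset.range (k + 1), Q.coeff i * ∫ p : ℂ × ℝ,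
      f p * cexp (-I * ((tau * p.2 : ℝ) : ℂ)) *
        (fockExp tau a 0 p.1 * (starRingEnd ℂ) p.1 ^ i) = 0 := by
    simp_rw [← integral_const_mul]
    rw [← integral_finsetSum _ fun i _ => Integrable.const_mul
      (integrable_mul_exp_neg_mul_comp_fst hf tau (hcont i)
        (norm_fockExp_mul_pow_le htau a 0 · i)) _]
    refine (mul_eq_zero.1 ?_).resolve_left hD0
    rw [← integral_const_mul]
    refine Eq.trans ?_ hrel
    refine integral_congr_ae (ae_of_all _ fun p => ?_)
    dsimp only
    rw [hker, ← hQeval, eval_eq_sum_range' hQdeg, Finset.mul_sum, Finset.mul_sum, Finset.mul_sum,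
      Finset.mul_sum]
    refine Finset.sum_congr rfl fun i _ => ?_
    ring
  rw [Finset.sum_range_succ, Finset.sum_eq_zero, zero_add] at hsum
  · exact (mul_eq_zero.1 hsum).resolve_left hQcoeff
  · intro i hi
    rw [ih i (Finset.mem_range.1 hi), mul_zero]

theorem integral_fockExp_eq_zero {f : ℂ × ℝ → ℂ} (hf : Integrable f)
    (hX : XrayVanishes f) {tau : ℝ} (htau : 0 < tau) (a b : ℂ) :
    ∫ p : ℂ × ℝ, f p * cexp (-I * ((tau * p.2 : ℝ) : ℂ)) * fockExp tau a b p.1 = 0 := by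
  have hconj : Continuous (starRingEnd ℂ) := Complex.continuous_conj
  have hcont := continuous_fockExp tau a 0
  have hexp (p : ℂ × ℝ) : HasSum (fun k : ℕ => ‖f p‖ * (‖fockExp tau a 0 p.1‖ *
      ((‖b‖ * ‖p.1‖) ^ k / k.factorial)))
      (‖f p‖ * (‖fockExp tau a 0 p.1‖ * rexp (‖b‖ * ‖p.1‖))) := by
    have := NormedSpace.expSeries_div_hasSum_exp (‖b‖ * ‖p.1‖)
    rw [← Real.exp_eq_exp_ℝ] at this
    exact (this.mul_left _).mul_left _
  have hsum : HasSum (fun k : ℕ => ∫ p : ℂ × ℝ, (b ^ k / k.factorial) *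
      (f p * cexp (-I * ((tau * p.2 : ℝ) : ℂ)) * (fockExp tau a 0 p.1 * (starRingEnd ℂ) p.1 ^ k)))
      (∫ p : ℂ × ℝ, f p * cexp (-I * ((tau * p.2 : ℝ) : ℂ)) * fockExp tau a b p.1) := by
    refine hasSum_integral_of_dominated_convergence (fun k p => ‖f p‖ * (‖fockExp tau a 0 p.1‖ *
      ((‖b‖ * ‖p.1‖) ^ k / k.factorial))) (fun k => ?_) (fun k => ae_of_all _ fun p => ?_)
      (ae_of_all _ fun p => (hexp p).summable) ?_ (ae_of_all _ fun p => ?_)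
    · exact ((integrable_mul_exp_neg_mul_comp_fst hf tau (hcont.mul (hconj.pow k))
        (norm_fockExp_mul_pow_le htau a 0 · k)).const_mul _).aestronglyMeasurable
    · rw [norm_mul, norm_mul, norm_mul, norm_mul, norm_exp_neg_I_mul_ofReal, norm_div, norm_pow,
        norm_pow, RCLike.norm_conj, Complex.norm_natCast, mul_pow]
      exact le_of_eq (by ring)
    · simp_rw [fun p => (hexp p).tsum_eq]
      refine hf.norm.mul_bdd (c := rexp ((‖a‖ + ‖(0 : ℂ)‖ + ‖b‖) ^ 2 / tau))
        (Continuous.aestronglyMeasurable (by fun_prop)) (ae_of_all _ fun p => ?_)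
      rw [Real.norm_of_nonneg (by positivity)]
      exact norm_fockExp_mul_exp_le htau a 0 p.1 ‖b‖
    · have := (NormedSpace.expSeries_div_hasSum_exp (b * (starRingEnd ℂ) p.1)).mul_left
        (f p * cexp (-I * ((tau * p.2 : ℝ) : ℂ)) * fockExp tau a 0 p.1)
      rw [← Complex.exp_eq_exp_ℂ] at this
      have e : fockExp tau a b p.1 = fockExp tau a 0 p.1 * cexp (b * (starRingEnd ℂ) p.1) := by
        rw [fockExp, fockExp, ← Complex.exp_add, zero_mul, add_zero]
      rw [e, ← mul_assoc]
      refine this.congr_fun fun k => ?_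
      rw [mul_pow]
      ring
  simp_rw [integral_const_mul, integral_fockExp_mul_conj_pow_eq_zero hf hX htau, mul_zero] at hsum
  exact hsum.unique hasSum_zero

theorem integral_exp_neg_mul_exp_dual_eq_zero {f : ℂ × ℝ → ℂ} (hf : Integrable f)
    (hX : XrayVanishes f) {tau : ℝ} (htau : 0 < tau) (L : StrongDual ℝ ℂ) :
    ∫ p : ℂ × ℝ, f p * cexp (-I * ((tau * p.2 : ℝ) : ℂ)) * cexp (L p.1 * I) = 0 := by
  set g : ℂ → ℂ := fun w => ∫ t : ℝ, f (w, t) * cexp (-I * ((tau * t : ℝ) : ℂ)) with hg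
  have hfub {h : ℂ → ℂ} (hc : Continuous h) {C : ℝ} (hC : ∀ z, ‖h z‖ ≤ C) :
      ∫ p : ℂ × ℝ, f p * cexp (-I * ((tau * p.2 : ℝ) : ℂ)) * h p.1 = ∫ w, g w * h w := by
    rw [Measure.volume_eq_prod,
      integral_prod _ (integrable_mul_exp_neg_mul_comp_fst hf tau hc hC)]
    simp_rw [hg, integral_mul_const]
  have hgint : Integrable g := by
    have := (integrable_mul_exp_neg_mul_comp_fst hf tau (continuous_const (y := (1 : ℂ)))
      (fun _ => le_rfl)).integral_prod_left
    simpa only [mul_one] using this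
  have hg0 : g =ᵐ[volume] 0 := by
    have hint : Integrable fun w => g w * fockExp tau 0 0 w :=
      hgint.mul_bdd (continuous_fockExp tau 0 0).aestronglyMeasurable
        (ae_of_all _ (norm_fockExp_le htau 0 0))
    have := ae_eq_zero_of_integral_exp_dual hint fun L => by
      refine Eq.trans ?_ ((hfub (continuous_fockExp _ _ _) (norm_fockExp_le htau _ _)).symm.trans
        (integral_fockExp_eq_zero hf hX htau (I * (L 1 - I * L I) / 2) (I * (L 1 + I * L I) / 2)))
      refine integral_congr_ae (ae_of_all _ fun w => ?_)
      dsimp only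
      rw [mul_assoc]
      congr 1
      rw [fockExp, fockExp, ← Complex.exp_add]
      congr 1
      have hL : L w = w.re * L 1 + w.im * L I := by
        conv_lhs => rw [show w = w.re • (1 : ℂ) + w.im • I by simp [Complex.re_add_im]]
        rw [map_add, map_smul, map_smul, smul_eq_mul, smul_eq_mul]
      have hw : w = w.re + w.im * I := (Complex.re_add_im w).symm
      have hw' : (starRingEnd ℂ) w = w.re - w.im * I := by
        apply Complex.ext <;> simp
      have h1 : I * (L 1 - I * L I) / 2 * w + I * (L 1 + I * L I) / 2 * (starRingEnd ℂ) w =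
          L w * I := by
        rw [hw', hL]
        nth_rewrite 1 [hw]
        push_cast
        linear_combination (-(w.im * L I * I : ℂ)) * I_sq
      linear_combination -h1
    filter_upwards [this] with w hw
    exact (mul_eq_zero.1 hw).resolve_right (Complex.exp_ne_zero _)
  rw [hfub (h := fun w => cexp (L w * I)) (C := 1) (by fun_prop)
    (fun z => (Complex.norm_exp_ofReal_mul_I _).le)]
  refine integral_eq_zero_of_ae ?_
  filter_upwards [hg0] with w hw
  simp [hw]

theorem XrayVanishes.conj {f : ℂ × ℝ → ℂ} (hX : XrayVanishes f) :
    XrayVanishes fun p => (starRingEnd ℂ) (f p) := by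
  obtain ⟨η, hη, hI⟩ := hX
  refine ⟨η, hη, fun lam hlam => ?_⟩
  filter_upwards [hI lam hlam] with p hp
  rw [xray, integral_conj, show ∫ s, f (hmul p (geo lam s)) = 0 from hp, map_zero]

theorem XrayVanishes.integral_exp_mul_exp_dual_eq_zero {f : ℂ × ℝ → ℂ} (hX : XrayVanishes f)
    (hf : Integrable f) (L : StrongDual ℝ ℂ) (θ : ℝ) :
    ∫ p : ℂ × ℝ, f p * cexp ((L p.1 + θ * p.2 : ℝ) * I) = 0 := by
  have hne {θ : ℝ} (hθ : θ ≠ 0) : ∫ p : ℂ × ℝ, f p * cexp ((L p.1 + θ * p.2 : ℝ) * I) = 0 := by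
    rcases hθ.lt_or_gt with hθ | hθ
    · rw [← integral_exp_neg_mul_exp_dual_eq_zero hf hX (neg_pos.2 hθ) L]
      refine integral_congr_ae (ae_of_all _ fun p => ?_)
      dsimp only
      rw [mul_assoc, ← Complex.exp_add]
      congr 2
      push_cast
      ring
    · have hconj : Integrable fun p => (starRingEnd ℂ) (f p) :=
        hf.congr' (by fun_prop) (ae_of_all _ fun x => by simp)
      rw [← map_zero (starRingEnd ℂ),
        ← integral_exp_neg_mul_exp_dual_eq_zero hconj hX.conj hθ (-L), ← integral_conj]
      refine integral_congr_ae (ae_of_all _ fun p => ?_)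
      simp only [map_mul, ← Complex.exp_conj, Complex.conj_conj, Complex.conj_ofReal, map_neg, conj_I,
        neg_neg, neg_apply]
      rw [mul_assoc, ← Complex.exp_add]
      congr 2
      push_cast
      ring
  have hcont : Continuous fun θ : ℝ => ∫ p : ℂ × ℝ, f p * cexp ((L p.1 + θ * p.2 : ℝ) * I) := by
    refine continuous_of_dominated (bound := fun p => ‖f p‖)
      (fun θ => hf.aestronglyMeasurable.mul (Continuous.aestronglyMeasurable (by fun_prop)))
      (fun θ => ae_of_all _ fun p => ?_) hf.norm (ae_of_all _ fun p => by fun_prop)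
    rw [norm_mul, Complex.norm_exp_ofReal_mul_I, mul_one]
  exact congrFun (hcont.ext_on (dense_compl_singleton (0 : ℝ)) continuous_const
    fun θ hθ => hne hθ) θ

theorem XrayVanishes.ae_eq_zero {f : ℂ × ℝ → ℂ} (hX : XrayVanishes f) (hf : Integrable f) :
    f =ᵐ[volume] 0 := by
  refine ae_eq_zero_of_integral_exp_dual hf fun L => ?_
  rw [← hX.integral_exp_mul_exp_dual_eq_zero hf (L.comp (.inl ℝ ℂ ℝ)) (L (0, 1))]
  refine integral_congr_ae (ae_of_all _ fun p => ?_)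
  dsimp only
  congr 4
  rw [← L.comp_inl_add_comp_inr]
  congr 1
  rw [ContinuousLinearMap.comp_apply, ContinuousLinearMap.inr_apply,
    show ((0 : ℂ), p.2) = p.2 • ((0 : ℂ), (1 : ℝ)) by simp, map_smul, smul_eq_mul, mul_comm]

/-- **Injectivity of the sub-Riemannian Heisenberg X-ray transform.**
If `f ∈ L¹(ℍ)` and for some `η > 0` the X-ray transform `I_λ f` vanishes almost everywhere
for every `λ ∈ (0, η)`, then `f = 0` almost everywhere. -/
theorem xray_injective (f : ℂ × ℝ → ℂ) (hf : Integrable f)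
    (η : ℝ) (hη : 0 < η)
    (hI : ∀ lam ∈ Set.Ioo (0 : ℝ) η, ∀ᵐ p : ℂ × ℝ, xray lam f p = 0) :
    f =ᵐ[volume] 0 := by
  exact XrayVanishes.ae_eq_zero ⟨η, hη, hI⟩ hf

end
end

section
/- Fourier Slice Theorem for the taming metric g_ε: for every ε > 0, every f ∈ L¹(ℍ), every λ > 0, every n ∈ ℤ∖{0}, every F ∈ 𝓗 and every ζ ∈ ℂ, one has ∫_{ℂ×[0,π(1/λ²+2ε²))} (I^ε_λ f)(z,t) · (β_{nλ²/(1+2ε²λ²)}(z,t)*F)(ζ) dz dt = (2π/λ) · (𝒥_n(1/√(1+2ε²λ²)) G)(ζ), where G := 𝓕_ℍ f(nλ²/(1+2ε²λ²)) F, i.e. G(ζ) = ∫_{ℂ×ℝ} f(w,s)(β_{nλ²/(1+2ε²λ²)}(w,s)*F)(ζ) dw ds. -/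
noncomputable section

open Complex MeasureTheory Real Set

/-- The model `g_ε`-geodesic of charge `lam`:
`γ^ε_λ(s) = (R e^{i s/R}, s (R² + 2ε²)/(2R))` with `R = 1/λ`. -/
def geoE (eps lam : ℝ) (s : ℝ) : ℂ × ℝ :=
  (((lam : ℂ))⁻¹ * Complex.exp (Complex.I * ((lam * s : ℝ) : ℂ)),
    s * (1 / lam ^ 2 + 2 * eps ^ 2) * lam / 2)

/-- The taming X-ray transform `I^ε_λ f (z,t) = ∫ f((z,t)·γ^ε_λ(s)) ds`. -/
def xrayE (eps lam : ℝ) (f : ℂ × ℝ → ℂ) (p : ℂ × ℝ) : ℂ :=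
  ∫ s : ℝ, f (hmul p (geoE eps lam s))

/-- The Bargmann–Fock representation for `h > 0`, acting pointwise. -/
def betaP (h : ℝ) (z : ℂ) (t : ℝ) (F : ℂ → ℂ) (ζ : ℂ) : ℂ :=
  Complex.exp (2 * Complex.I * (h : ℂ) * (t : ℂ) - ((Real.sqrt h : ℝ) : ℂ) * ζ * (starRingEnd ℂ) z
      - ((h : ℂ) / 2) * ((Complex.normSq z : ℝ) : ℂ)) * F (ζ + ((Real.sqrt h : ℝ) : ℂ) * z)

/-- The Bargmann–Fock representation `β_h(z,t)` for `h ≠ 0`: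
for `h < 0` it is `β_{|h|}(conj z, −t)`. -/
def beta (h : ℝ) (z : ℂ) (t : ℝ) (F : ℂ → ℂ) (ζ : ℂ) : ℂ :=
  if 0 < h then betaP h z t F ζ else betaP |h| ((starRingEnd ℂ) z) (-t) F ζ

/-- The adjoint `β_h(z,t)* = β_h((z,t)⁻¹) = β_h(−z,−t)`. -/
def betaStar (h : ℝ) (p : ℂ × ℝ) (F : ℂ → ℂ) (ζ : ℂ) : ℂ :=
  beta h (-p.1) (-p.2) F ζ

/-- Membership in Bargmann–Fock space `𝓗`: entire with
`(1/π) ∫_ℂ |F(ζ)|² e^{−|ζ|²} dζ < ∞`. -/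
def InFock (F : ℂ → ℂ) : Prop :=
  Differentiable ℂ F ∧
    Integrable (fun ζ : ℂ => ‖F ζ‖ ^ 2 * Real.exp (-Complex.normSq ζ))

/-- The group Fourier transform `𝓕_ℍ f(h)`, acting pointwise on `F ∈ 𝓗`:
`(𝓕_ℍ f(h) F)(ζ) = ∫_{ℂ×ℝ} f(z,t) (β_h(z,t)* F)(ζ) dz dt`. -/
def fourierH (f : ℂ × ℝ → ℂ) (h : ℝ) (F : ℂ → ℂ) (ζ : ℂ) : ℂ :=
  ∫ p : ℂ × ℝ, f p * betaStar h p F ζ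

/-- The multiplier operator `𝒥_n(r)`:
`(𝒥_n(r) F)(ζ) = (1/2π) ∫₀^{2π} (β_n(r e^{iθ}, θ/2) F)(ζ) dθ`. -/
def Jop (n : ℤ) (r : ℝ) (F : ℂ → ℂ) (ζ : ℂ) : ℂ :=
  ((1 / (2 * π) : ℝ) : ℂ) *
    ∫ θ in (0 : ℝ)..(2 * π), beta (n : ℝ) (((r : ℝ) : ℂ) * Complex.exp (Complex.I * (θ : ℂ))) (θ / 2) F ζ

theorem norm_sq_le_integral_gaussian {G : ℂ → ℂ} (hG : Differentiable ℂ G)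
    (hint : Integrable fun ζ : ℂ => ‖G ζ‖ ^ 2 * Real.exp (-normSq ζ)) :
    π * ‖G 0‖ ^ 2 ≤ ∫ ζ : ℂ, ‖G ζ‖ ^ 2 * Real.exp (-normSq ζ) := by
  set H : ℂ → ℂ := fun ζ => G ζ ^ 2 * (Real.exp (-normSq ζ) : ℂ) with hH
  have hnorm (ζ : ℂ) : ‖H ζ‖ = ‖G ζ‖ ^ 2 * Real.exp (-normSq ζ) := by
    simp only [hH, norm_mul, norm_pow, norm_real, Real.norm_eq_abs, abs_exp]
  have hHc : Continuous H := by
    have := hG.continuous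
    have := continuous_normSq
    fun_prop
  have hHi : Integrable H := by
    rw [← integrable_norm_iff hHc.aestronglyMeasurable]
    simpa only [hnorm] using hint
  have hrot : MeasurePreserving (fun p : ℝ × ℂ => (p.1, circleMap 0 1 p.1 * p.2))
      ((volume.restrict (Ioc 0 (2 * π))).prod volume)
      ((volume.restrict (Ioc 0 (2 * π))).prod volume) := by
    refine (MeasurePreserving.id _).skew_product
      (g := fun (θ : ℝ) (ζ : ℂ) => circleMap 0 1 θ * ζ) ?_ (.of_forall fun θ => ?_)
    · exact Continuous.measurable (by unfold Function.uncurry; fun_prop)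
    · have := (rotation (Circle.exp θ)).measurePreserving.map_eq
      convert this using 2
      ext ζ
      simp [circleMap]
  have hprod : Integrable (fun p : ℝ × ℂ => H (circleMap 0 1 p.1 * p.2))
      ((volume.restrict (Ioc 0 (2 * π))).prod volume) :=
    hrot.integrable_comp_of_integrable (hHi.comp_snd _)
  have hswap := integral_integral_swap (f := fun θ ζ => H (circleMap 0 1 θ * ζ)) hprod
  have hleft (θ : ℝ) : ∫ ζ, H (circleMap 0 1 θ * ζ) = ∫ ζ, H ζ := by
    have := (rotation (Circle.exp θ)).measurePreserving.integral_comp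
      (rotation (Circle.exp θ)).toHomeomorph.measurableEmbedding H
    simpa [circleMap] using this
  have hright (ζ : ℂ) : ∫ θ in Ioc 0 (2 * π), H (circleMap 0 1 θ * ζ)
      = (2 * π * G 0 ^ 2 : ℂ) * (Real.exp (-1 * ‖ζ‖ ^ 2) : ℂ) := by
    have hmean : circleAverage (fun w => G (w * ζ) ^ 2) 0 1 = G (0 * ζ) ^ 2 := by
      refine DiffContOnCl.circleAverage (f := fun w => G (w * ζ) ^ 2) (Differentiable.diffContOnCl ?_)
      fun_prop
    rw [circleAverage_def, inv_smul_eq_iff₀ (by positivity),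
      intervalIntegral.integral_of_le (by positivity)] at hmean
    have hn (θ : ℝ) : normSq (circleMap 0 1 θ * ζ) = 1 * ‖ζ‖ ^ 2 := by
      rw [normSq_eq_norm_sq, norm_mul, norm_circleMap_zero, abs_one, one_mul, one_mul]
    simp only [hH, hn]
    rw [integral_mul_const, hmean]
    simp
  have hgauss : ∫ ζ : ℂ, Real.exp (-1 * ‖ζ‖ ^ 2) = π := by
    simpa using GaussianFourier.integral_rexp_neg_mul_sq_norm (V := ℂ) one_pos
  simp only [hleft, hright] at hswap
  rw [integral_const_mul, integral_complex_ofReal, hgauss] at hswap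
  have hval : ∫ ζ, H ζ = π * G 0 ^ 2 := by
    have h2 : (2 * π : ℂ) ≠ 0 := by simp [pi_ne_zero]
    apply mul_left_cancel₀ h2
    rw [← mul_assoc]
    rw [setIntegral_const, measureReal_def, Real.volume_Ioc, sub_zero,
      ENNReal.toReal_ofReal (by positivity), real_smul] at hswap
    push_cast at hswap
    rw [hswap]
    ring
  calc π * ‖G 0‖ ^ 2 = ‖∫ ζ, H ζ‖ := by
        rw [hval, norm_mul, norm_pow, norm_real, Real.norm_of_nonneg pi_pos.le]
    _ ≤ ∫ ζ, ‖H ζ‖ := norm_integral_le_integral_norm _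
    _ = _ := by simp only [hnorm]

theorem InFock.exists_norm_le {F : ℂ → ℂ} (hF : InFock F) :
    ∃ C, ∀ w, ‖F w‖ ≤ C * Real.exp (normSq w / 2) := by
  obtain ⟨hd, hi⟩ := hF
  set M := ∫ ζ : ℂ, ‖F ζ‖ ^ 2 * Real.exp (-normSq ζ) with hM
  refine ⟨√(M / π), fun w => ?_⟩
  let G : ℂ → ℂ := fun ζ => F (ζ + w) * Complex.exp (-(ζ * (starRingEnd ℂ) w) - (normSq w / 2 : ℝ))
  have hG : Differentiable ℂ G := by
    have : Differentiable ℂ fun ζ => F (ζ + w) := hd.comp (by fun_prop)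
    fun_prop
  have hGn (ζ : ℂ) : ‖G ζ‖ ^ 2 * Real.exp (-normSq ζ)
      = ‖F (ζ + w)‖ ^ 2 * Real.exp (-normSq (ζ + w)) := by
    simp only [G, norm_mul, Complex.norm_exp, mul_pow, mul_assoc]
    rw [← Real.exp_nat_mul, ← Real.exp_add]
    congr 2
    simp [normSq_apply]
    ring
  have key := norm_sq_le_integral_gaussian hG (by simpa only [hGn] using hi.comp_add_right w)
  simp only [hGn] at key
  rw [integral_add_right_eq_self (fun ζ : ℂ => ‖F ζ‖ ^ 2 * Real.exp (-normSq ζ)) w, ← hM] at key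
  have h0 : ‖G 0‖ = ‖F w‖ * Real.exp (-(normSq w / 2)) := by
    simp [G, Complex.norm_exp]
  have h1 : ‖G 0‖ ≤ √(M / π) := by
    apply Real.le_sqrt_of_sq_le
    rw [le_div_iff₀ pi_pos]
    linarith
  rw [h0, Real.exp_neg, ← div_eq_mul_inv, div_le_iff₀ (Real.exp_pos _)] at h1
  exact h1

theorem InFock.exists_norm_betaP_le {F : ℂ → ℂ} (hF : InFock F) (ζ : ℂ) :
    ∃ C, ∀ h, 0 ≤ h → ∀ z t, ‖betaP h z t F ζ‖ ≤ C := by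
  obtain ⟨C, hC⟩ := hF.exists_norm_le
  refine ⟨C * Real.exp (normSq ζ / 2), fun h hh z t => ?_⟩
  rw [betaP, norm_mul, Complex.norm_exp]
  refine (mul_le_mul_of_nonneg_left (hC _) (Real.exp_nonneg _)).trans_eq ?_
  rw [mul_left_comm, ← Real.exp_add]
  congr 2
  have := Real.sq_sqrt hh
  simp [normSq_apply]
  linear_combination (z.re ^ 2 + z.im ^ 2) / 2 * this

theorem InFock.exists_norm_betaStar_le {F : ℂ → ℂ} (hF : InFock F) (h : ℝ) (ζ : ℂ) :
    ∃ C, ∀ p, ‖betaStar h p F ζ‖ ≤ C := by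
  obtain ⟨C, hC⟩ := hF.exists_norm_betaP_le ζ
  refine ⟨C, fun p => ?_⟩
  unfold betaStar beta
  split_ifs with hh
  · exact hC _ hh.le _ _
  · exact hC _ (abs_nonneg h) _ _

theorem continuous_betaStar {F : ℂ → ℂ} (hF : Continuous F) (h : ℝ) (ζ : ℂ) :
    Continuous fun p => betaStar h p F ζ := by
  have := continuous_normSq
  have := Complex.continuous_conj
  unfold betaStar beta betaP
  split_ifs <;> fun_prop

theorem betaP_betaP {h : ℝ} (hh : 0 ≤ h) (p q : ℂ × ℝ) (F : ℂ → ℂ) (ζ : ℂ) :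
    betaP h p.1 p.2 (betaP h q.1 q.2 F) ζ = betaP h (hmul p q).1 (hmul p q).2 F ζ := by
  have hs : ((√h : ℝ) : ℂ) ^ 2 = h := by rw [← ofReal_pow, Real.sq_sqrt hh]
  simp only [betaP, hmul]
  rw [← mul_assoc, ← Complex.exp_add]
  congr 2
  · rw [← hs]
    obtain ⟨⟨x, y⟩, t⟩ := p
    obtain ⟨⟨u, v⟩, s⟩ := q
    apply Complex.ext <;> simp [normSq_apply, pow_two] <;> ring
  · ring

theorem beta_beta (h : ℝ) (p q : ℂ × ℝ) (F : ℂ → ℂ) (ζ : ℂ) :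
    beta h p.1 p.2 (beta h q.1 q.2 F) ζ = beta h (hmul p q).1 (hmul p q).2 F ζ := by
  by_cases hh : 0 < h
  · have hb (z t F) : beta h z t F = betaP h z t F := by ext; simp [beta, hh]
    simp only [hb, betaP_betaP hh.le]
  · have hb (z t F) : beta h z t F = betaP |h| ((starRingEnd ℂ) z) (-t) F := by
      ext; simp [beta, hh]
    simp only [hb]
    rw [betaP_betaP (abs_nonneg h) ((starRingEnd ℂ) p.1, -p.2) ((starRingEnd ℂ) q.1, -q.2)]
    congr 1
    · simp [hmul]
    · simp [hmul]
      ring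

theorem beta_fourierH (f : ℂ × ℝ → ℂ) (h : ℝ) (F : ℂ → ℂ) (q : ℂ × ℝ) (ζ : ℂ) :
    beta h q.1 q.2 (fourierH f h F) ζ
      = ∫ p, f p * betaStar h (hmul p (-q.1, -q.2)) F ζ := by
  have hinv (p : ℂ × ℝ) : betaStar h (hmul p (-q.1, -q.2)) F ζ
      = beta h q.1 q.2 (betaStar h p F) ζ := by
    change _ = beta h q.1 q.2 (beta h (-p.1, -p.2).1 (-p.1, -p.2).2 F) ζ
    rw [beta_beta, betaStar]
    congr 1
    · simp [hmul]
    · simp [hmul]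
      ring
  simp only [hinv]
  unfold beta betaP fourierH
  split_ifs <;> simp only [mul_left_comm (f _), integral_const_mul]

/-- Right translation on the Heisenberg group. -/
def hmulRight (q : ℂ × ℝ) : (ℂ × ℝ) ≃ₜ (ℂ × ℝ) where
  toFun p := hmul p q
  invFun p := hmul p (-q.1, -q.2)
  left_inv p := by ext <;> simp [hmul]; ring
  right_inv p := by ext <;> simp [hmul]; ring
  continuous_toFun := by
    have := Complex.continuous_re
    have := Complex.continuous_im
    unfold hmul
    fun_prop
  continuous_invFun := by
    have := Complex.continuous_re
    have := Complex.continuous_im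
    unfold hmul
    fun_prop

theorem measurePreserving_hmulRight (q : ℂ × ℝ) : MeasurePreserving (hmulRight q) := by
  refine (measurePreserving_add_right volume q.1).skew_product
    (g := fun (z : ℂ) (t : ℝ) => t + q.2 + (z.re * q.1.im - z.im * q.1.re) / 2) ?_
    (.of_forall fun z => ?_)
  · exact Continuous.measurable (by unfold Function.uncurry; fun_prop)
  · simp only [add_assoc]
    exact map_add_right_eq_self volume _

theorem isAddFundamentalDomain_preimage_Ico {E : Type*} [AddCommGroup E] [MeasurableSpace E]
    {μ : Measure E} {φ : E → ℝ} (hφ : Measurable φ) {v : E} {a : ℝ} (ha : 0 < a)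
    (hadd : ∀ (m : ℤ) x, φ (m • v + x) = φ x + m • a) (b : ℝ) :
    IsAddFundamentalDomain (AddSubgroup.zmultiples v) (φ ⁻¹' Ico b (b + a)) μ := by
  refine IsAddFundamentalDomain.mk' (hφ measurableSet_Ico).nullMeasurableSet fun x => ?_
  have hinj : Function.Injective fun m : ℤ => m • v := by
    intro m k hmk
    have h1 := hadd m 0
    rw [show m • v = k • v from hmk, hadd] at h1
    exact ((zsmul_left_strictMono ha).injective (add_left_cancel h1)).symm
  have : Function.Bijective (codRestrict (fun m : ℤ => m • v) (AddSubgroup.zmultiples v)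
      fun m => ⟨m, rfl⟩) := (Equiv.ofInjective _ hinj).bijective
  refine this.existsUnique_iff.2 ?_
  have h := existsUnique_add_zsmul_mem_Ico ha (φ x) b
  simpa only [← hadd] using! h

theorem hmul_geoE_sub_period {lam : ℝ} (hlam : lam ≠ 0) (eps : ℝ) (z : ℂ) (t s : ℝ) (m : ℤ) :
    hmul (z, t + m * (π * (1 / lam ^ 2 + 2 * eps ^ 2))) (geoE eps lam (s - m * (2 * π / lam)))
      = hmul (z, t) (geoE eps lam s) := by
  have hexp : Complex.exp (I * ((lam * (s - m * (2 * π / lam)) : ℝ) : ℂ))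
      = Complex.exp (I * ((lam * s : ℝ) : ℂ)) := by
    rw [Complex.exp_eq_exp_iff_exists_int]
    refine ⟨-m, ?_⟩
    have : (lam : ℂ) ≠ 0 := by exact_mod_cast hlam
    push_cast
    field_simp
    ring
  simp only [hmul, geoE, hexp, Prod.mk.injEq, true_and]
  field_simp
  ring

theorem betaStar_add_period {h T : ℝ} {n : ℤ} (hT : h * T = n * π) (z : ℂ) (t : ℝ) (m : ℤ)
    (F : ℂ → ℂ) (ζ : ℂ) : betaStar h (z, t + m * T) F ζ = betaStar h (z, t) F ζ := by
  have hT' : (h : ℂ) * T = n * π := by exact_mod_cast hT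
  unfold betaStar beta betaP
  split_ifs with hh
  · congr 1
    rw [Complex.exp_eq_exp_iff_exists_int]
    refine ⟨-(m * n), ?_⟩
    push_cast
    linear_combination (-2 * I * m) * hT'
  · congr 1
    rw [Complex.exp_eq_exp_iff_exists_int, abs_of_nonpos (not_lt.mp hh)]
    refine ⟨-(m * n), ?_⟩
    push_cast
    linear_combination (-2 * I * m) * hT'

theorem beta_geoE {eps lam : ℝ} (hlam : 0 < lam) (n : ℤ) (s : ℝ) (F : ℂ → ℂ) (ζ : ℂ) :
    beta ((n : ℝ) * lam ^ 2 / (1 + 2 * eps ^ 2 * lam ^ 2)) (geoE eps lam s).1 (geoE eps lam s).2 F ζ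
      = beta n (((1 / √(1 + 2 * eps ^ 2 * lam ^ 2) : ℝ) : ℂ) *
          Complex.exp (I * ((lam * s : ℝ) : ℂ))) (lam * s / 2) F ζ := by
  set D := 1 + 2 * eps ^ 2 * lam ^ 2 with hD
  have hD0 : 0 < D := by positivity
  have hiff : 0 < (n : ℝ) * lam ^ 2 / D ↔ 0 < (n : ℝ) := by
    rw [div_pos_iff_of_pos_right hD0, mul_pos_iff_of_pos_right (by positivity)]
  have hsqrt (a : ℝ) : √(a * lam ^ 2 / D) * lam⁻¹ = √a * (1 / √D) := by
    rw [Real.sqrt_div' _ hD0.le, Real.sqrt_mul' _ (by positivity), Real.sqrt_sq hlam.le]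
    field_simp
  have key (a : ℝ) (e : ℂ) (he : normSq e = 1) (t : ℝ) :
      betaP (a * lam ^ 2 / D) ((lam⁻¹ : ℝ) * e) (t * (1 / lam ^ 2 + 2 * eps ^ 2) * lam / 2) F ζ
        = betaP a ((1 / √D : ℝ) * e) (lam * t / 2) F ζ := by
    have h1 : ((√(a * lam ^ 2 / D) : ℝ) : ℂ) * (lam⁻¹ : ℝ) = (√a : ℝ) * (1 / √D : ℝ) := by
      exact_mod_cast hsqrt a
    have h2 : ((a * lam ^ 2 / D : ℝ) : ℂ) * ((t * (1 / lam ^ 2 + 2 * eps ^ 2) * lam / 2 : ℝ) : ℂ)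
        = (a : ℂ) * ((lam * t / 2 : ℝ) : ℂ) := by
      have : a * lam ^ 2 / D * (t * (1 / lam ^ 2 + 2 * eps ^ 2) * lam / 2) = a * (lam * t / 2) := by
        field_simp
        rw [hD]
        ring
      exact_mod_cast this
    have h3 : ((a * lam ^ 2 / D : ℝ) : ℂ) * ((lam⁻¹ * lam⁻¹ * 1 : ℝ) : ℂ)
        = (a : ℂ) * ((1 / √D * (1 / √D) * 1 : ℝ) : ℂ) := by
      have : a * lam ^ 2 / D * (lam⁻¹ * lam⁻¹ * 1) = a * (1 / √D * (1 / √D) * 1) := by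
        rw [div_mul_div_comm, Real.mul_self_sqrt hD0.le]
        field_simp
      exact_mod_cast this
    unfold betaP
    rw [normSq_mul, normSq_mul, normSq_ofReal, normSq_ofReal, he, map_mul, map_mul, conj_ofReal,
      conj_ofReal]
    congr 2
    · linear_combination 2 * I * h2 - ζ * (starRingEnd ℂ) e * h1 - h3 / 2
    · linear_combination e * h1
  have he (θ : ℝ) : normSq (Complex.exp (I * (θ : ℂ))) = 1 := by
    rw [mul_comm, normSq_eq_norm_sq, norm_exp_ofReal_mul_I, one_pow]
  unfold beta geoE
  simp only [hiff, ← ofReal_inv]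
  split_ifs with hn
  · exact key _ _ (he _) _
  · rw [abs_div, abs_mul, abs_of_pos hD0, abs_of_pos (pow_pos hlam 2), map_mul, map_mul, conj_ofReal,
      conj_ofReal]
    convert key |(n : ℝ)| _ (by rw [normSq_conj]; exact he (lam * s)) (-s) using 2 <;> ring

/-- **Fourier Slice Theorem for the taming metric `g_ε`.**
For `ε > 0`, `f ∈ L¹(ℍ)`, `λ > 0`, `n ∈ ℤ∖{0}`, `F ∈ 𝓗`, `ζ ∈ ℂ`:
`∫_{ℂ×[0,π(1/λ²+2ε²))} (I^ε_λ f)(z,t) (β_{nλ²/(1+2ε²λ²)}(z,t)* F)(ζ) dz dt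
  = (2π/λ) (𝒥_n(1/√(1+2ε²λ²)) (𝓕_ℍ f(nλ²/(1+2ε²λ²)) F))(ζ)`. -/
theorem taming_fourier_slice (eps : ℝ) (heps : 0 < eps)
    (f : ℂ × ℝ → ℂ) (hf : Integrable f)
    (lam : ℝ) (hlam : 0 < lam) (n : ℤ) (hn : n ≠ 0)
    (F : ℂ → ℂ) (hF : InFock F) (ζ : ℂ) :
    ∫ p in (Set.univ : Set ℂ) ×ˢ Set.Ico (0 : ℝ) (π * (1 / lam ^ 2 + 2 * eps ^ 2)),
        xrayE eps lam f p * betaStar ((n : ℝ) * lam ^ 2 / (1 + 2 * eps ^ 2 * lam ^ 2)) p F ζ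
      = ((2 * π / lam : ℝ) : ℂ) *
          Jop n (1 / Real.sqrt (1 + 2 * eps ^ 2 * lam ^ 2))
            (fourierH f ((n : ℝ) * lam ^ 2 / (1 + 2 * eps ^ 2 * lam ^ 2)) F) ζ := by
  set h := (n : ℝ) * lam ^ 2 / (1 + 2 * eps ^ 2 * lam ^ 2) with hh
  set T := π * (1 / lam ^ 2 + 2 * eps ^ 2) with hTdef
  set L := 2 * π / lam with hL
  have hT : 0 < T := by positivity
  have hL0 : 0 < L := by positivity
  have hhT : h * T = n * π := by
    rw [hh, hTdef]
    field_simp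
  set Ψ : ℝ × (ℂ × ℝ) → ℂ := fun x => f (hmul x.2 (geoE eps lam x.1)) * betaStar h x.2 F ζ with hΨ
  have hK := continuous_betaStar hF.1.continuous h ζ
  have hgeo : Continuous (geoE eps lam) := by unfold geoE; fun_prop
  have hshear : MeasurePreserving
      (fun x : ℝ × (ℂ × ℝ) => (x.1, hmul x.2 (geoE eps lam x.1)))
      ((volume.restrict (Ioc 0 L)).prod volume) ((volume.restrict (Ioc 0 L)).prod volume) := by
    refine (MeasurePreserving.id _).skew_product
      (g := fun (s : ℝ) (p : ℂ × ℝ) => hmul p (geoE eps lam s)) ?_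
      (.of_forall fun s => (measurePreserving_hmulRight (geoE eps lam s)).map_eq)
    have := Complex.continuous_re
    have := Complex.continuous_im
    exact Continuous.measurable (by unfold Function.uncurry hmul; fun_prop)
  have hΨi : Integrable Ψ ((volume.restrict (Ioc 0 L)).prod volume) := by
    obtain ⟨C, hC⟩ := hF.exists_norm_betaStar_le h ζ
    exact (hshear.integrable_comp_of_integrable (hf.comp_snd _)).mul_bdd (c := C)
      (hK.comp continuous_snd).aestronglyMeasurable (.of_forall fun x => hC x.2)
  have hperiod (m : ℤ) (x : ℝ × (ℂ × ℝ)) :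
      m • ((-L, (0, T)) : ℝ × (ℂ × ℝ)) + x = (x.1 - m * L, (x.2.1, x.2.2 + m * T)) := by
    ext <;> simp <;> ring
  have hdom₁ : IsAddFundamentalDomain (AddSubgroup.zmultiples ((-L, (0, T)) : ℝ × (ℂ × ℝ)))
      ((univ : Set ℝ) ×ˢ ((univ : Set ℂ) ×ˢ Ico 0 T)) volume := by
    have hset : (univ : Set ℝ) ×ˢ ((univ : Set ℂ) ×ˢ Ico 0 T)
        = (fun x : ℝ × (ℂ × ℝ) => x.2.2) ⁻¹' Ico 0 (0 + T) := by ext; simp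
    rw [hset]
    exact isAddFundamentalDomain_preimage_Ico (by fun_prop) hT
      (fun m x => by rw [hperiod, zsmul_eq_mul]) 0
  have hdom₂ : IsAddFundamentalDomain (AddSubgroup.zmultiples ((-L, (0, T)) : ℝ × (ℂ × ℝ)))
      (Ioc 0 L ×ˢ (univ : Set (ℂ × ℝ))) volume := by
    have hset : Ioc 0 L ×ˢ (univ : Set (ℂ × ℝ))
        = (fun x : ℝ × (ℂ × ℝ) => L - x.1) ⁻¹' Ico 0 (0 + L) := by ext; simp [and_comm]
    rw [hset]
    exact isAddFundamentalDomain_preimage_Ico (by fun_prop) hL0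
      (fun m x => by rw [hperiod, zsmul_eq_mul]; ring) 0
  have hinv (g : AddSubgroup.zmultiples ((-L, (0, T)) : ℝ × (ℂ × ℝ))) (x : ℝ × (ℂ × ℝ)) :
      Ψ (g +ᵥ x) = Ψ x := by
    obtain ⟨_, m, rfl⟩ := g
    change Ψ (m • ((-L, (0, T)) : ℝ × (ℂ × ℝ)) + x) = Ψ x
    rw [hperiod]
    simp only [hΨ, betaStar_add_period hhT]
    simp only [hL, hTdef, hmul_geoE_sub_period hlam.ne']
  have hvol₁ : (volume : Measure (ℝ × (ℂ × ℝ))).restrict (univ ×ˢ (univ ×ˢ Ico 0 T))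
      = volume.prod (volume.restrict (univ ×ˢ Ico 0 T)) := by
    rw [Measure.volume_eq_prod, ← Measure.prod_restrict, Measure.restrict_univ]
  have hvol₂ : (volume : Measure (ℝ × (ℂ × ℝ))).restrict (Ioc 0 L ×ˢ univ)
      = (volume.restrict (Ioc 0 L)).prod volume := by
    rw [Measure.volume_eq_prod, ← Measure.prod_restrict, Measure.restrict_univ]
  have hleft : (volume : Measure (ℝ × (ℂ × ℝ))).IsAddLeftInvariant :=
    have : (volume : Measure (ℂ × ℝ)).IsAddLeftInvariant := Measure.prod.instIsAddLeftInvariant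
    Measure.prod.instIsAddLeftInvariant
  have hΨi' : Integrable Ψ (volume.prod (volume.restrict (univ ×ˢ Ico 0 T))) := by
    rw [← hvol₁]
    refine (hdom₁.integrableOn_iff hdom₂ hinv).2 ?_
    rwa [IntegrableOn, hvol₂]
  have hslice (s : ℝ) : ∫ p, Ψ (s, p)
      = beta h (geoE eps lam s).1 (geoE eps lam s).2 (fourierH f h F) ζ := by
    rw [beta_fourierH]
    refine Eq.trans ?_ ((measurePreserving_hmulRight (geoE eps lam s)).integral_comp
      (hmulRight (geoE eps lam s)).measurableEmbedding _)
    refine integral_congr_ae (.of_forall fun p => ?_)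
    change _ = f (hmul p (geoE eps lam s)) *
      betaStar h ((hmulRight (geoE eps lam s)).symm (hmulRight (geoE eps lam s) p)) F ζ
    rw [Homeomorph.symm_apply_apply]
  calc ∫ p in univ ×ˢ Ico 0 T, xrayE eps lam f p * betaStar h p F ζ
      = ∫ p in univ ×ˢ Ico 0 T, ∫ s, Ψ (s, p) := by
        simp only [xrayE, hΨ, integral_mul_const]
    _ = ∫ x in (univ : Set ℝ) ×ˢ ((univ : Set ℂ) ×ˢ Ico 0 T), Ψ x := by
        rw [hvol₁, integral_prod_symm _ hΨi']
    _ = ∫ x in Ioc 0 L ×ˢ (univ : Set (ℂ × ℝ)), Ψ x := hdom₁.setIntegral_eq hdom₂ hinv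
    _ = ∫ s in (0 : ℝ)..L, beta h (geoE eps lam s).1 (geoE eps lam s).2 (fourierH f h F) ζ := by
        rw [hvol₂, integral_prod _ hΨi, intervalIntegral.integral_of_le hL0.le]
        simp only [hslice]
    _ = _ := by
        simp only [hh, beta_geoE hlam]
        rw [intervalIntegral.integral_comp_mul_left (fun θ : ℝ => beta n
          (((1 / √(1 + 2 * eps ^ 2 * lam ^ 2) : ℝ) : ℂ) * Complex.exp (I * (θ : ℂ))) (θ / 2)
          (fourierH f (n * lam ^ 2 / (1 + 2 * eps ^ 2 * lam ^ 2)) F) ζ) hlam.ne', Jop, ← mul_assoc,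
          ← ofReal_mul, real_smul, mul_zero, hL, mul_div_cancel₀ _ hlam.ne']
        congr 2
        field_simp

end
end
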